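/- arXiv:0806.2467 — 9 statements merged into one kernel-verified Lean document; each statement's English description precedes it below -/
import Mathlib

section
/- Let g be a finite-dimensional real Lie algebra and N : g → g a linear map. For every α ∈ g* and all x, y, z ∈ g, (d_N(d_N α))(x,y,z) = −( α([T_N(x,y), z] + T_N([x,y], z)) + α([T_N(y,z), x] + T_N([y,z], x)) + α([T_N(z,x), y] + T_N([z,x], y)) ), where d_N := i_N ∘ d − d ∘ i_N. -/
noncomputable section
open Module

variable {g : Type*} [LieRing g] [LieAlgebra ℝ g]

/-- coadjoint action: `(coad x γ) y = -γ ⁅x, y⁆`. -/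
def coad (x : g) (γ : Dual ℝ g) : Dual ℝ g := -(γ ∘ₗ LieAlgebra.ad ℝ g x)

/-- bracket on the dual induced by a skew map `π`: `[α,β]_π = ad*_{π α} β - ad*_{π β} α`. -/
def brP (π : Dual ℝ g →ₗ[ℝ] g) (α β : Dual ℝ g) : Dual ℝ g :=
  coad (π α) β - coad (π β) α

/-- deformed bracket `[x,y]_N`. -/
def brN (N : g →ₗ[ℝ] g) (x y : g) : g := ⁅N x, y⁆ + ⁅x, N y⁆ - N ⁅x, y⁆

/-- Nijenhuis torsion of `N`. -/
def TN (N : g →ₗ[ℝ] g) (x y : g) : g := ⁅N x, N y⁆ - N (brN N x y)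

/-- `[α,β]_{Nπ}`. -/
def brNP (π : Dual ℝ g →ₗ[ℝ] g) (N : g →ₗ[ℝ] g) (α β : Dual ℝ g) : Dual ℝ g :=
  coad (N (π α)) β - coad (N (π β)) α

/-- `[α,β]_π^{N^t}`. -/
def brPNt (π : Dual ℝ g →ₗ[ℝ] g) (N : g →ₗ[ℝ] g) (α β : Dual ℝ g) : Dual ℝ g :=
  brP π (N.dualMap α) β + brP π α (N.dualMap β) - N.dualMap (brP π α β)

/-- Magri–Morosi concomitant `C(π,N)`. -/
def MM (π : Dual ℝ g →ₗ[ℝ] g) (N : g →ₗ[ℝ] g) (α β : Dual ℝ g) : Dual ℝ g :=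
  brNP π N α β - brPNt π N α β

/-- torsion of `N^t` with respect to `[·,·]_π`. -/
def TNdual (π : Dual ℝ g →ₗ[ℝ] g) (N : g →ₗ[ℝ] g) (α β : Dual ℝ g) : Dual ℝ g :=
  brP π (N.dualMap α) (N.dualMap β) - N.dualMap (brPNt π N α β)

/-- Chevalley–Eilenberg differential of a 2-form `σ`, with two arguments plugged in:
`(d2 σ x y) z = -σ ⁅x,y⁆ z + σ ⁅x,z⁆ y - σ ⁅y,z⁆ x`. -/
def d2 (σ : g →ₗ[ℝ] Dual ℝ g) (x y : g) : Dual ℝ g :=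
  -(σ ⁅x, y⁆) + (σ ∘ₗ LieAlgebra.ad ℝ g x).flip y - (σ ∘ₗ LieAlgebra.ad ℝ g y).flip x

/-- the canonical symmetric pairing on `g ⊕ g*`. -/
def pairE (e f : g × Dual ℝ g) : ℝ := e.2 f.1 + f.2 e.1

/-- a paired operator on `g ⊕ g*`. -/
def Paired (𝒩 : g × Dual ℝ g →ₗ[ℝ] g × Dual ℝ g) : Prop :=
  ∀ e f, pairE (𝒩 e) f + pairE e (𝒩 f) = 0

/-- untwisted double bracket on `g ⊕ g*`. -/
def dbl (e f : g × Dual ℝ g) : g × Dual ℝ g :=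
  (⁅e.1, f.1⁆, coad e.1 f.2 - coad f.1 e.2)

/-- the `𝒩`-deformed untwisted double bracket. -/
def dblN (𝒩 : g × Dual ℝ g →ₗ[ℝ] g × Dual ℝ g) (e f : g × Dual ℝ g) : g × Dual ℝ g :=
  dbl (𝒩 e) f + dbl e (𝒩 f) - 𝒩 (dbl e f)

/-- Courant–Nijenhuis torsion of `𝒩` (untwisted bracket). -/
def Tcal (𝒩 : g × Dual ℝ g →ₗ[ℝ] g × Dual ℝ g) (e f : g × Dual ℝ g) : g × Dual ℝ g :=
  dbl (𝒩 e) (𝒩 f) - 𝒩 (dblN 𝒩 e f)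

/-- the `φ`-twisted double bracket on `g ⊕ g*`. -/
def dblT (φ : g →ₗ[ℝ] g →ₗ[ℝ] Dual ℝ g) (e f : g × Dual ℝ g) : g × Dual ℝ g :=
  (⁅e.1, f.1⁆, coad e.1 f.2 - coad f.1 e.2 + φ e.1 f.1)

/-- the `𝒩`-deformed `φ`-twisted double bracket. -/
def dblTN (φ : g →ₗ[ℝ] g →ₗ[ℝ] Dual ℝ g) (𝒩 : g × Dual ℝ g →ₗ[ℝ] g × Dual ℝ g)
    (e f : g × Dual ℝ g) : g × Dual ℝ g :=
  dblT φ (𝒩 e) f + dblT φ e (𝒩 f) - 𝒩 (dblT φ e f)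

/-- Courant–Nijenhuis torsion of `𝒩` with respect to the `φ`-twisted bracket. -/
def TcalT (φ : g →ₗ[ℝ] g →ₗ[ℝ] Dual ℝ g) (𝒩 : g × Dual ℝ g →ₗ[ℝ] g × Dual ℝ g)
    (e f : g × Dual ℝ g) : g × Dual ℝ g :=
  dblT φ (𝒩 e) (𝒩 f) - 𝒩 (dblTN φ 𝒩 e f)

/-- a trilinear form (curried, `Dual`-valued) is alternating. -/
def IsAlt3 (φ : g →ₗ[ℝ] g →ₗ[ℝ] Dual ℝ g) : Prop :=
  (∀ x z : g, φ x x z = 0) ∧ (∀ x y : g, φ x y y = 0)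

/-- `i_N` applied to a trilinear form, with two arguments plugged in. -/
def iN3 (N : g →ₗ[ℝ] g) (φ : g →ₗ[ℝ] g →ₗ[ℝ] Dual ℝ g) (x y : g) : Dual ℝ g :=
  φ (N x) y + φ x (N y) + (φ x y) ∘ₗ N

/-- Chevalley–Eilenberg differential of a 3-form given as a plain function. -/
def d3 (F : g → g → g → ℝ) (x y z w : g) : ℝ :=
  -F ⁅x, y⁆ z w + F ⁅x, z⁆ y w - F ⁅x, w⁆ y z - F ⁅y, z⁆ x w + F ⁅y, w⁆ x z - F ⁅z, w⁆ x y

/-- Chevalley–Eilenberg differential of a 1-form (plain function). -/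
def d1f (α : g → ℝ) (x y : g) : ℝ := -α ⁅x, y⁆

/-- Chevalley–Eilenberg differential of a 2-form (plain function). -/
def d2f (τ : g → g → ℝ) (x y z : g) : ℝ := -τ ⁅x, y⁆ z + τ ⁅x, z⁆ y - τ ⁅y, z⁆ x

/-- `i_N` on 1-forms. -/
def iN1f (N : g →ₗ[ℝ] g) (α : g → ℝ) (x : g) : ℝ := α (N x)

/-- `i_N` on 2-forms. -/
def iN2f (N : g →ₗ[ℝ] g) (τ : g → g → ℝ) (x y : g) : ℝ := τ (N x) y + τ x (N y)

/-- `i_N` on 3-forms. -/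
def iN3f (N : g →ₗ[ℝ] g) (F : g → g → g → ℝ) (x y z : g) : ℝ :=
  F (N x) y z + F x (N y) z + F x y (N z)

/-- `d_N = i_N ∘ d - d ∘ i_N` on 1-forms. -/
def dN1 (N : g →ₗ[ℝ] g) (α : g → ℝ) (x y : g) : ℝ :=
  iN2f N (d1f α) x y - d1f (iN1f N α) x y

/-- `d_N = i_N ∘ d - d ∘ i_N` on 2-forms. -/
def dN2 (N : g →ₗ[ℝ] g) (τ : g → g → ℝ) (x y z : g) : ℝ :=
  iN3f N (d2f τ) x y z - d2f (iN2f N τ) x y z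

/-- The Jacobi identity for left-normed brackets, evaluated on a linear form. -/
theorem apply_jacobi (φ : Dual ℝ g) (a b c : g) :
    φ ⁅⁅a, b⁆, c⁆ - φ ⁅⁅a, c⁆, b⁆ + φ ⁅⁅b, c⁆, a⁆ = 0 := by
  rw [← map_sub, ← map_add, lie_lie, ← lie_skew ⁅a, c⁆ b, ← lie_skew ⁅b, c⁆ a,
    sub_neg_eq_add, sub_add_cancel, add_neg_cancel, map_zero]

theorem dN_squared_eq_torsion [FiniteDimensional ℝ g]
    (N : g →ₗ[ℝ] g) (α : Dual ℝ g) (x y z : g) :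
    dN2 N (dN1 N (⇑α)) x y z =
      -(α (⁅TN N x y, z⁆ + TN N ⁅x, y⁆ z) +
        α (⁅TN N y z, x⁆ + TN N ⁅y, z⁆ x) +
        α (⁅TN N z x, y⁆ + TN N ⁅z, x⁆ y)) := by
  have hzx : ⁅z, x⁆ = -⁅x, z⁆ := (lie_skew _ _).symm
  have h₁ := apply_jacobi α (N x) (N y) z
  have h₂ := apply_jacobi α (N x) y (N z)
  have h₃ := apply_jacobi α x (N y) (N z)
  have h₄ := apply_jacobi (α ∘ₗ N) (N x) y z
  have h₅ := apply_jacobi (α ∘ₗ N) x (N y) z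
  have h₆ := apply_jacobi (α ∘ₗ N) x y (N z)
  have h₇ := apply_jacobi (α ∘ₗ N ∘ₗ N) x y z
  have hNzNx : ⁅N z, N x⁆ = -⁅N x, N z⁆ := (lie_skew _ _).symm
  have e₁ : ⁅x, N y⁆ = -⁅N y, x⁆ := (lie_skew _ _).symm
  have e₂ : ⁅x, N z⁆ = -⁅N z, x⁆ := (lie_skew _ _).symm
  have e₃ : ⁅y, N z⁆ = -⁅N z, y⁆ := (lie_skew _ _).symm
  have e₄ : ⁅z, N x⁆ = -⁅N x, z⁆ := (lie_skew _ _).symm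
  simp only [dN2, dN1, iN3f, iN2f, iN1f, d2f, d1f, TN, brN, LinearMap.comp_apply, hzx, hNzNx,
    e₁, e₂, e₃, e₄, map_add, map_sub, map_neg, add_lie, sub_lie, neg_lie]
    at h₁ h₂ h₃ h₄ h₅ h₆ h₇ ⊢
  linarith
end
end

section
/- Let g be a finite-dimensional real Lie algebra and 𝒩 a paired linear endomorphism of g ⊕ g* with components (N, π, σ, −N^t). If the Courant–Nijenhuis torsion of 𝒩 (with respect to the untwisted double bracket) vanishes on g*, i.e. T_𝒩(α,β) = 0 for all α, β ∈ g*, then π([α,β]_π) = [π(α), π(β)] for all α, β ∈ g*, and the bracket [·,·]_π satisfies the Jacobi identity, so (g*, [·,·]_π) is a Lie algebra and π is a Lie algebra morphism. -/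
noncomputable section
open Module

variable {g : Type*} [LieRing g] [LieAlgebra ℝ g]

lemma coad_sub (x : g) (α β : Dual ℝ g) : coad x (α - β) = coad x α - coad x β := by
  ext y
  simp only [coad, LinearMap.neg_apply, LinearMap.comp_apply, LinearMap.sub_apply]
  ring

lemma coad_lie (x y : g) (γ : Dual ℝ g) :
    coad ⁅x, y⁆ γ = coad x (coad y γ) - coad y (coad x γ) := by
  ext z
  simp only [coad, LinearMap.neg_apply, LinearMap.comp_apply, LinearMap.sub_apply,
    LieAlgebra.ad_apply, lie_lie, map_sub]
  ring

/-- If `π` intertwines the brackets, then `[·,·]_π` satisfies the Jacobi identity. -/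
lemma brP_jacobi (π : Dual ℝ g →ₗ[ℝ] g) (h : ∀ α β : Dual ℝ g, π (brP π α β) = ⁅π α, π β⁆)
    (α β γ : Dual ℝ g) :
    brP π (brP π α β) γ + brP π (brP π β γ) α + brP π (brP π γ α) β = 0 := by
  have key : ∀ α β γ : Dual ℝ g, brP π (brP π α β) γ =
      coad (π α) (coad (π β) γ) - coad (π β) (coad (π α) γ)
        - (coad (π γ) (coad (π α) β) - coad (π γ) (coad (π β) α)) := by
    intro α β γ
    rw [brP, h, coad_lie, brP, coad_sub]
  rw [key, key, key]
  abel

theorem torsion_free_on_dual_gives_lie [FiniteDimensional ℝ g]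
    (N : g →ₗ[ℝ] g) (π : Dual ℝ g →ₗ[ℝ] g) (σ : g →ₗ[ℝ] Dual ℝ g)
    (𝒩 : g × Dual ℝ g →ₗ[ℝ] g × Dual ℝ g)
    (hpair : Paired 𝒩)
    (hcomp : ∀ (x : g) (α : Dual ℝ g), 𝒩 (x, α) = (N x + π α, σ x - N.dualMap α))
    (hT : ∀ α β : Dual ℝ g, Tcal 𝒩 ((0 : g), α) ((0 : g), β) = 0) :
    (∀ α β : Dual ℝ g, π (brP π α β) = ⁅π α, π β⁆) ∧
    (∀ α β γ : Dual ℝ g,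
      brP π (brP π α β) γ + brP π (brP π β γ) α + brP π (brP π γ α) β = 0) := by
  have h : ∀ α β : Dual ℝ g, π (brP π α β) = ⁅π α, π β⁆ := by
    intro α β
    have h1 := congrArg Prod.fst (hT α β)
    have h2 : dblN 𝒩 ((0 : g), α) ((0 : g), β) = (0, brP π α β) := by
      simp [dblN, dbl, hcomp, brP, coad, sub_eq_add_neg]
    rw [Tcal, h2] at h1
    simp only [hcomp, dbl, map_zero, zero_add, Prod.fst_sub, Prod.fst_zero] at h1
    exact (sub_eq_zero.mp h1).symm
  exact ⟨h, brP_jacobi π h⟩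
end
end

section
/- Let g be a finite-dimensional real Lie algebra and 𝒩 a paired linear endomorphism of g ⊕ g* with components (N, π, σ, −N^t), and assume N∘π = π∘N^t. Then T_𝒩(α,β) = 0 for all α, β ∈ g* (torsion with respect to the untwisted double bracket) if and only if both: (i) π([α,β]_π) = [π(α), π(β)] for all α, β ∈ g*, and (ii) the Magri–Morosi concomitant vanishes, C(π,N)(α,β) = 0 for all α, β ∈ g*. -/
noncomputable section
open Module

variable {g : Type*} [LieRing g] [LieAlgebra ℝ g]

/-- On `g*` the torsion has components the Poisson defect of `π` and the concomitant. -/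
lemma Tcal_dual_eq (N : g →ₗ[ℝ] g) (π : Dual ℝ g →ₗ[ℝ] g) (σ : g →ₗ[ℝ] Dual ℝ g)
    (𝒩 : g × Dual ℝ g →ₗ[ℝ] g × Dual ℝ g)
    (hcomp : ∀ (x : g) (α : Dual ℝ g), 𝒩 (x, α) = (N x + π α, σ x - N.dualMap α))
    (hNπ : N ∘ₗ π = π ∘ₗ N.dualMap) (α β : Dual ℝ g) :
    Tcal 𝒩 ((0 : g), α) ((0 : g), β) = (⁅π α, π β⁆ - π (brP π α β), MM π N α β) := by
  have coad_zero_left (γ : Dual ℝ g) : coad (0 : g) γ = 0 := by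
    ext; simp [coad]
  have coad_neg_right (x : g) (γ : Dual ℝ g) : coad x (-γ) = -coad x γ := by
    ext; simp [coad]
  have hN (γ : Dual ℝ g) : N (π γ) = π (N.dualMap γ) := LinearMap.congr_fun hNπ γ
  have hdual (γ : Dual ℝ g) : 𝒩 (0, γ) = (π γ, -N.dualMap γ) := by simp [hcomp]
  have hdbl : dblN 𝒩 ((0 : g), α) ((0 : g), β) = (0, brP π α β) := by
    simp [dblN, dbl, hdual, coad_zero_left, brP, sub_eq_add_neg]
  rw [Tcal, hdbl, hdual, hdual, hdual]
  ext1
  · rfl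
  · simp only [dbl, MM, brNP, brPNt, hN, coad_neg_right, Prod.snd_sub]
    simp only [brP]
    abel

theorem torsion_on_dual_iff_poisson_and_concomitant [FiniteDimensional ℝ g]
    (N : g →ₗ[ℝ] g) (π : Dual ℝ g →ₗ[ℝ] g) (σ : g →ₗ[ℝ] Dual ℝ g)
    (𝒩 : g × Dual ℝ g →ₗ[ℝ] g × Dual ℝ g)
    (hpair : Paired 𝒩)
    (hcomp : ∀ (x : g) (α : Dual ℝ g), 𝒩 (x, α) = (N x + π α, σ x - N.dualMap α))
    (hNπ : N ∘ₗ π = π ∘ₗ N.dualMap) :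
    (∀ α β : Dual ℝ g, Tcal 𝒩 ((0 : g), α) ((0 : g), β) = 0) ↔
      ((∀ α β : Dual ℝ g, π (brP π α β) = ⁅π α, π β⁆) ∧
        (∀ α β : Dual ℝ g, MM π N α β = 0)) := by
  simp only [Tcal_dual_eq N π σ 𝒩 hcomp hNπ, Prod.mk_eq_zero, sub_eq_zero, forall_and]
  simp only [eq_comm]
end
end

section
/- Let g be a finite-dimensional real Lie algebra and 𝒩 a paired linear endomorphism of g ⊕ g* with components (N, π, σ, −N^t); assume N∘π = π∘N^t and σ(Nx, y) = σ(x, Ny) for all x, y ∈ g. Then T_𝒩(x,y) = 0 for all x, y ∈ g (torsion with respect to the untwisted double bracket) if and only if both: (i) T_N(x,y) = π((dσ)(x,y,·)) for all x, y ∈ g, and (ii) d(Nσ) = i_N(dσ), where (Nσ)(x,y) := σ(Nx, y). -/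
noncomputable section
open Module

variable {g : Type*} [LieRing g] [LieAlgebra ℝ g]

/-- Skew-symmetry of the `g → g*` component of a paired operator. -/
lemma Paired.skew {N : g →ₗ[ℝ] g} {π : Dual ℝ g →ₗ[ℝ] g} {σ : g →ₗ[ℝ] Dual ℝ g}
    {𝒩 : g × Dual ℝ g →ₗ[ℝ] g × Dual ℝ g} (hpair : Paired 𝒩)
    (hcomp : ∀ (x : g) (α : Dual ℝ g), 𝒩 (x, α) = (N x + π α, σ x - N.dualMap α)) (x y : g) :
    σ x y = -σ y x := by
  have h := hpair (x, 0) (y, 0)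
  simp only [hcomp, pairE, map_zero, sub_zero, LinearMap.zero_apply, add_zero, zero_add] at h
  linarith

lemma coad_sub_coad_apply {σ : g →ₗ[ℝ] Dual ℝ g} (hσ : ∀ x y, σ x y = -σ y x) (a b x y z : g) :
    (coad a (σ y) - coad b (σ x)) z = σ ⁅a, z⁆ y - σ ⁅b, z⁆ x := by
  simp only [coad, LinearMap.sub_apply, LinearMap.neg_apply, LinearMap.comp_apply,
    LieAlgebra.ad_apply]
  rw [hσ y, hσ x]
  ring

lemma d2_apply (σ : g →ₗ[ℝ] Dual ℝ g) (x y z : g) :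
    d2 σ x y z = -σ ⁅x, y⁆ z + σ ⁅x, z⁆ y - σ ⁅y, z⁆ x := by
  simp [d2]

/-- On `g`, the torsion splits into a `g`-component and a `g*`-component. -/
lemma Tcal_algebra {N : g →ₗ[ℝ] g} {π : Dual ℝ g →ₗ[ℝ] g} {σ : g →ₗ[ℝ] Dual ℝ g}
    {𝒩 : g × Dual ℝ g →ₗ[ℝ] g × Dual ℝ g}
    (hcomp : ∀ (x : g) (α : Dual ℝ g), 𝒩 (x, α) = (N x + π α, σ x - N.dualMap α))
    (hσ : ∀ x y, σ x y = -σ y x) (x y : g) :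
    Tcal 𝒩 (x, (0 : Dual ℝ g)) (y, (0 : Dual ℝ g)) =
      (TN N x y - π (d2 σ x y),
        coad (N x) (σ y) - coad (N y) (σ x) - (σ (brN N x y) - N.dualMap (d2 σ x y))) := by
  have h0 (a : g) : coad a (0 : Dual ℝ g) = 0 := by simp [coad]
  have hdef : dblN 𝒩 (x, (0 : Dual ℝ g)) (y, (0 : Dual ℝ g)) = (brN N x y, d2 σ x y) := by
    have hd : d2 σ x y = coad x (σ y) - coad y (σ x) - σ ⁅x, y⁆ := by
      ext z
      rw [LinearMap.sub_apply, coad_sub_coad_apply hσ, d2_apply]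
      ring
    simp only [dblN, dbl, hcomp, h0, map_zero, add_zero, sub_zero, hd]
    ext1
    · simp [brN]
    · simp only [Prod.snd_add, Prod.snd_sub]
      abel
  rw [Tcal, hdef, hcomp, hcomp, hcomp]
  simp only [dbl, map_zero, add_zero, sub_zero, TN, Prod.mk_sub_mk, sub_sub]

theorem torsion_on_algebra_iff [FiniteDimensional ℝ g]
    (N : g →ₗ[ℝ] g) (π : Dual ℝ g →ₗ[ℝ] g) (σ : g →ₗ[ℝ] Dual ℝ g)
    (𝒩 : g × Dual ℝ g →ₗ[ℝ] g × Dual ℝ g)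
    (hpair : Paired 𝒩)
    (hcomp : ∀ (x : g) (α : Dual ℝ g), 𝒩 (x, α) = (N x + π α, σ x - N.dualMap α))
    (hNπ : N ∘ₗ π = π ∘ₗ N.dualMap)
    (hσN : ∀ x y : g, σ (N x) y = σ x (N y)) :
    (∀ x y : g, Tcal 𝒩 (x, (0 : Dual ℝ g)) (y, (0 : Dual ℝ g)) = 0) ↔
      ((∀ x y : g, TN N x y = π (d2 σ x y)) ∧
        (∀ x y z : g,
          d2 (σ ∘ₗ N) x y z = d2 σ (N x) y z + d2 σ x (N y) z + d2 σ x y (N z))) := by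
  have hσ := hpair.skew hcomp
  have key (x y z : g) :
      (coad (N x) (σ y) - coad (N y) (σ x) - (σ (brN N x y) - N.dualMap (d2 σ x y))) z =
        d2 σ (N x) y z + d2 σ x (N y) z + d2 σ x y (N z) - d2 (σ ∘ₗ N) x y z := by
    rw [LinearMap.sub_apply, coad_sub_coad_apply hσ]
    simp only [brN, LinearMap.sub_apply, LinearMap.dualMap_apply, map_add, map_sub,
      LinearMap.add_apply, d2_apply, LinearMap.comp_apply, hσN]
    ring
  simp only [Tcal_algebra hcomp hσ, Prod.mk_eq_zero, sub_eq_zero (a := TN N _ _), forall_and,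
    LinearMap.ext_iff, key, LinearMap.zero_apply]
  exact and_congr_right fun _ => forall₃_congr fun _ _ _ => sub_eq_zero.trans eq_comm
end
end

section
/- Let g be a finite-dimensional real Lie algebra and 𝒩 a paired linear endomorphism of g ⊕ g* with components (N, π, σ, −N^t); assume N∘π = π∘N^t and σ(Nx, y) = σ(x, Ny) for all x, y ∈ g. If T_𝒩(α,β) = 0 for all α, β ∈ g* and T_𝒩(x,y) = 0 for all x, y ∈ g (torsions with respect to the untwisted double bracket), then (g, π, N, dσ) is a Poisson quasi-Nijenhuis Lie algebra; explicitly: π([α,β]_π) = [π(α), π(β)] for all α, β ∈ g*; C(π,N) = 0; T_N(x,y) = π((dσ)(x,y,·)) for all x, y ∈ g; d(dσ) = 0; and d(i_N(dσ)) = 0. -/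
noncomputable section
open Module

variable {g : Type*} [LieRing g] [LieAlgebra ℝ g]

lemma coad_apply (x : g) (γ : Dual ℝ g) (y : g) : coad x γ y = -γ ⁅x, y⁆ := rfl

/-- The Chevalley–Eilenberg differential squares to zero on 2-forms. -/
lemma d3_d2_eq_zero (τ : g →ₗ[ℝ] Dual ℝ g) (hτ : ∀ x y, τ x y = -τ y x) (x y z w : g) :
    d3 (fun a b c => d2 τ a b c) x y z w = 0 := by
  have jacobi (a b c d : g) : τ ⁅⁅a, b⁆, c⁆ d - τ ⁅⁅a, c⁆, b⁆ d + τ ⁅⁅b, c⁆, a⁆ d = 0 := by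
    have h : ⁅⁅a, b⁆, c⁆ - ⁅⁅a, c⁆, b⁆ + ⁅⁅b, c⁆, a⁆ = 0 := by
      rw [lie_lie a b c, ← lie_skew b ⁅a, c⁆, ← lie_skew a ⁅b, c⁆]
      abel
    rw [← LinearMap.sub_apply, ← LinearMap.add_apply, ← map_sub, ← map_add, h, map_zero,
      LinearMap.zero_apply]
  simp only [d3, d2_apply]
  linarith [jacobi x y z w, jacobi x y w z, jacobi x z w y, jacobi y z w x,
    hτ ⁅x, y⁆ ⁅z, w⁆, hτ ⁅x, z⁆ ⁅y, w⁆, hτ ⁅x, w⁆ ⁅y, z⁆]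

/-- The differential of a 2-form, written through the coadjoint action. -/
lemma d2_eq_coad (σ : g →ₗ[ℝ] Dual ℝ g) (hσ : ∀ x y, σ x y = -σ y x) (x y : g) :
    d2 σ x y = coad x (σ y) - coad y (σ x) - σ ⁅x, y⁆ := by
  ext z
  simp only [d2_apply, LinearMap.sub_apply, coad_apply]
  linarith [hσ y ⁅x, z⁆, hσ x ⁅y, z⁆]

theorem paired_operator_gives_poisson_quasi_nijenhuis [FiniteDimensional ℝ g]
    (N : g →ₗ[ℝ] g) (π : Dual ℝ g →ₗ[ℝ] g) (σ : g →ₗ[ℝ] Dual ℝ g)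
    (𝒩 : g × Dual ℝ g →ₗ[ℝ] g × Dual ℝ g)
    (hpair : Paired 𝒩)
    (hcomp : ∀ (x : g) (α : Dual ℝ g), 𝒩 (x, α) = (N x + π α, σ x - N.dualMap α))
    (hNπ : N ∘ₗ π = π ∘ₗ N.dualMap)
    (hσN : ∀ x y : g, σ (N x) y = σ x (N y))
    (hTdual : ∀ α β : Dual ℝ g, Tcal 𝒩 ((0 : g), α) ((0 : g), β) = 0)
    (hTalg : ∀ x y : g, Tcal 𝒩 (x, (0 : Dual ℝ g)) (y, (0 : Dual ℝ g)) = 0) :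
    (∀ α β : Dual ℝ g, π (brP π α β) = ⁅π α, π β⁆) ∧
    (∀ α β : Dual ℝ g, MM π N α β = 0) ∧
    (∀ x y : g, TN N x y = π (d2 σ x y)) ∧
    (∀ x y z w : g, d3 (fun a b c => d2 σ a b c) x y z w = 0) ∧
    (∀ x y z w : g,
      d3 (fun a b c => d2 σ (N a) b c + d2 σ a (N b) c + d2 σ a b (N c)) x y z w = 0) := by
  have hσ (x y : g) : σ x y = -σ y x := by
    have h := hpair (x, 0) (y, 0)
    simp only [hcomp, pairE, map_zero, add_zero, sub_zero, LinearMap.zero_apply, zero_add] at h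
    linarith
  have hdual (α β : Dual ℝ g) : ⁅π α, π β⁆ = π (brP π α β) ∧
      coad (π α) (N.dualMap β) - coad (π β) (N.dualMap α) = N.dualMap (brP π α β) := by
    have h := hTdual α β
    have hb : dblN 𝒩 ((0 : g), α) ((0 : g), β) = (0, brP π α β) := by
      ext <;> simp [dblN, dbl, hcomp, brP, coad]
    rw [Tcal, hb] at h
    simp only [hcomp, dbl, map_zero, zero_add, zero_sub, Prod.mk_sub_mk, Prod.mk_eq_zero,
      sub_eq_zero] at h
    refine ⟨h.1, ?_⟩
    rw [← neg_inj, ← h.2]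
    ext z
    simp only [LinearMap.neg_apply, LinearMap.sub_apply, coad_apply]
    ring
  have halg (x y : g) : ⁅N x, N y⁆ = N (brN N x y) + π (d2 σ x y) ∧
      coad (N x) (σ y) - coad (N y) (σ x) = σ (brN N x y) - N.dualMap (d2 σ x y) := by
    have h := hTalg x y
    have hb : dblN 𝒩 (x, (0 : Dual ℝ g)) (y, (0 : Dual ℝ g)) = (brN N x y, d2 σ x y) := by
      rw [d2_eq_coad σ hσ]
      refine Prod.ext ?_ ?_
      · simp [dblN, dbl, hcomp, brN, coad]
      · ext z
        simp [dblN, dbl, hcomp, coad]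
        ring
    rw [Tcal, hb] at h
    simpa only [hcomp, dbl, map_zero, add_zero, sub_zero, Prod.mk_sub_mk, Prod.mk_eq_zero,
      sub_eq_zero] using h
  have hcomm (α : Dual ℝ g) : π (N.dualMap α) = N (π α) := (LinearMap.congr_fun hNπ α).symm
  refine ⟨fun α β => (hdual α β).1.symm, fun α β => ?_, fun x y => ?_, d3_d2_eq_zero σ hσ,
    fun x y z w => ?_⟩
  · simp only [MM, brNP, brPNt]
    rw [← (hdual α β).2]
    simp only [brP, hcomm]
    abel
  · rw [TN, (halg x y).1, add_sub_cancel_left]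
  · have hskew (a b : g) : (σ ∘ₗ N) a b = -(σ ∘ₗ N) b a := by
      simp only [LinearMap.comp_apply]
      rw [hσN, hσ]
    have key (a b c : g) :
        d2 σ (N a) b c + d2 σ a (N b) c + d2 σ a b (N c) = d2 (σ ∘ₗ N) a b c := by
      have h := LinearMap.congr_fun (halg a b).2 c
      simp only [brN, map_sub, map_add, LinearMap.sub_apply, LinearMap.add_apply, coad_apply,
        LinearMap.dualMap_apply] at h
      simp only [d2_apply, LinearMap.comp_apply] at h ⊢
      linarith [hσ b ⁅N a, c⁆, hσ a ⁅N b, c⁆, hσN ⁅a, c⁆ b, hσN ⁅b, c⁆ a]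
    simp only [key]
    exact d3_d2_eq_zero _ hskew x y z w
end
end

section
/- Let g be a finite-dimensional real Lie algebra, π : g* → g skew-symmetric with π([α,β]_π) = [π(α), π(β)] for all α, β ∈ g*, and N : g → g a linear map compatible with π, i.e. N∘π = π∘N^t and C(π,N) = 0. Then for all α, β ∈ g* and x ∈ g, T_{N^t}(α,β)(x) = α(T_N(x, π(β))), where T_{N^t} is the torsion of N^t with respect to the Lie bracket [·,·]_π on g*. -/
noncomputable section
open Module

variable {g : Type*} [LieRing g] [LieAlgebra ℝ g]

/-- The vanishing of the concomitant `MM π N`, evaluated on a vector. -/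
lemma apply_lie_of_MM_eq_zero (N : g →ₗ[ℝ] g) (π : Dual ℝ g →ₗ[ℝ] g)
    (hNπ : N ∘ₗ π = π ∘ₗ N.dualMap) (α β : Dual ℝ g) (hC : MM π N α β = 0) (x : g) :
    α (N ⁅π β, x⁆) - β (N ⁅π α, x⁆) + β ⁅π α, N x⁆ - α ⁅π β, N x⁆ = 0 := by
  have hπ : ∀ γ, π (N.dualMap γ) = N (π γ) := fun γ => (LinearMap.congr_fun hNπ γ).symm
  have h := LinearMap.congr_fun hC x
  simp only [MM, brNP, brPNt, brP, coad, hπ, LinearMap.sub_apply, LinearMap.add_apply,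
    LinearMap.neg_apply, LinearMap.comp_apply, LieAlgebra.ad_apply, LinearMap.dualMap_apply,
    LinearMap.zero_apply] at h
  linarith

theorem torsion_dual_eq_torsion [FiniteDimensional ℝ g]
    (N : g →ₗ[ℝ] g) (π : Dual ℝ g →ₗ[ℝ] g)
    (hskew : ∀ α β : Dual ℝ g, α (π β) = -β (π α))
    (hpois : ∀ α β : Dual ℝ g, π (brP π α β) = ⁅π α, π β⁆)
    (hNπ : N ∘ₗ π = π ∘ₗ N.dualMap)
    (hC : ∀ α β : Dual ℝ g, MM π N α β = 0) :
    ∀ (α β : Dual ℝ g) (x : g), TNdual π N α β x = α (TN N x (π β)) := by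
  intro α β x
  have hπ : ∀ γ, π (N.dualMap γ) = N (π γ) := fun γ => (LinearMap.congr_fun hNπ γ).symm
  have h := apply_lie_of_MM_eq_zero N π hNπ (N.dualMap α) β (hC _ _) x
  have hbr : brPNt π N α β = brNP π N α β := (sub_eq_zero.mp (hC α β)).symm
  rw [hπ] at h
  simp only [LinearMap.dualMap_apply] at h
  simp only [TNdual, hbr, brNP, brP, coad, hπ, TN, brN, LinearMap.sub_apply,
    LinearMap.neg_apply, LinearMap.comp_apply, LieAlgebra.ad_apply, LinearMap.dualMap_apply,
    map_sub, map_add]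
  rw [← lie_skew (N x) (N (π β)), ← lie_skew (N x) (π β), ← lie_skew x (N (π β)),
    ← lie_skew x (π β)]
  simp only [map_neg]
  linarith
end
end

section
/- Let (g, π, N, φ) be a Poisson quasi-Nijenhuis Lie algebra. Then for all α, β ∈ g* and x ∈ g, T_{N^t}(α,β)(x) = φ(π(α), π(β), x), where T_{N^t} is the torsion of N^t with respect to the Lie bracket [·,·]_π on g*. -/
noncomputable section
open Module

variable {g : Type*} [LieRing g] [LieAlgebra ℝ g]

/-- Evaluated at `x`, the condition `C(π,N)(α,β) = 0` says that `α ∘ N` and `β ∘ N` can be traded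
for `N` acting inside the bracket. -/
theorem MM_apply (π : Dual ℝ g →ₗ[ℝ] g) (N : g →ₗ[ℝ] g)
    (hNπ : ∀ γ : Dual ℝ g, π (N.dualMap γ) = N (π γ)) (α β : Dual ℝ g) (x : g) :
    MM π N α β x =
      α (⁅π β, N x⁆ - N ⁅π β, x⁆) - β (⁅π α, N x⁆ - N ⁅π α, x⁆) := by
  simp [MM, brNP, brPNt, brP, coad, hNπ]
  ring

/-- When `C(π,N)` vanishes, the torsion of `N^t` is minus the transpose of the torsion of `N`. -/
theorem TNdual_apply_of_MM_eq_zero (π : Dual ℝ g →ₗ[ℝ] g) (N : g →ₗ[ℝ] g)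
    (hNπ : ∀ γ : Dual ℝ g, π (N.dualMap γ) = N (π γ))
    (hC : ∀ α β : Dual ℝ g, MM π N α β = 0) (α β : Dual ℝ g) (x : g) :
    TNdual π N α β x = -α (TN N (π β) x) := by
  have hbr : brPNt π N α β = brNP π N α β := (sub_eq_zero.mp (hC α β)).symm
  have h := MM_apply π N hNπ (N.dualMap α) β x
  rw [hC] at h
  simp only [hNπ, LinearMap.zero_apply, LinearMap.dualMap_apply, map_sub] at h
  simp [TNdual, hbr, brNP, brP, coad, hNπ, TN, brN]
  linarith

theorem pqn_torsion_dual_eq_phi [FiniteDimensional ℝ g]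
    (N : g →ₗ[ℝ] g) (π : Dual ℝ g →ₗ[ℝ] g) (φ : g →ₗ[ℝ] g →ₗ[ℝ] Dual ℝ g)
    -- Poisson quasi-Nijenhuis structure:
    (hskew : ∀ α β : Dual ℝ g, α (π β) = -β (π α))
    (hpois : ∀ α β : Dual ℝ g, π (brP π α β) = ⁅π α, π β⁆)
    (hNπ : N ∘ₗ π = π ∘ₗ N.dualMap)
    (hC : ∀ α β : Dual ℝ g, MM π N α β = 0)
    (hφ : IsAlt3 φ)
    (hdφ : ∀ x y z w : g, d3 (fun a b c => φ a b c) x y z w = 0)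
    (hdiNφ : ∀ x y z w : g, d3 (fun a b c => iN3 N φ a b c) x y z w = 0)
    (hTN : ∀ x y : g, TN N x y = π (φ x y)) :
    ∀ (α β : Dual ℝ g) (x : g), TNdual π N α β x = φ (π α) (π β) x := by
  intro α β x
  have hswap : ∀ a b c : g, φ a b c = -φ b a c := fun a b c => by
    have h := hφ.1 (a + b) c
    simp only [map_add, LinearMap.add_apply, hφ.1] at h
    linarith
  have hswap' : ∀ a b c : g, φ a b c = -φ a c b := fun a b c => by
    have h := hφ.2 a (b + c)
    simp only [map_add, LinearMap.add_apply, hφ.2] at h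
    linarith
  rw [TNdual_apply_of_MM_eq_zero π N (fun γ => (LinearMap.congr_fun hNπ γ).symm) hC, hTN, hskew,
    neg_neg, hswap', hswap, neg_neg]
end
end

section
/- Let (g, π, N, φ) be a Poisson quasi-Nijenhuis Lie algebra and suppose φ = N*ψ for some alternating trilinear form ψ on g, i.e. φ(x,y,z) = ψ(Nx, Ny, Nz) for all x, y, z. Then N^t is a bracket morphism from the ψ-twisted bracket of Nπ to [·,·]_π: for all α, β ∈ g*, N^t([α,β]^ψ_{Nπ}) = [N^t α, N^t β]_π, where [α,β]^ψ_{Nπ} := ad*_{N(π(α))} β − ad*_{N(π(β))} α + ψ(N(π(α)), N(π(β)), ·). -/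
noncomputable section
open Module

variable {g : Type*} [LieRing g] [LieAlgebra ℝ g]

theorem pqn_dual_morphism [FiniteDimensional ℝ g]
    (N : g →ₗ[ℝ] g) (π : Dual ℝ g →ₗ[ℝ] g)
    (φ ψ : g →ₗ[ℝ] g →ₗ[ℝ] Dual ℝ g)
    -- Poisson quasi-Nijenhuis structure:
    (hskew : ∀ α β : Dual ℝ g, α (π β) = -β (π α))
    (hpois : ∀ α β : Dual ℝ g, π (brP π α β) = ⁅π α, π β⁆)
    (hNπ : N ∘ₗ π = π ∘ₗ N.dualMap)
    (hC : ∀ α β : Dual ℝ g, MM π N α β = 0)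
    (hφ : IsAlt3 φ)
    (hdφ : ∀ x y z w : g, d3 (fun a b c => φ a b c) x y z w = 0)
    (hdiNφ : ∀ x y z w : g, d3 (fun a b c => iN3 N φ a b c) x y z w = 0)
    (hTN : ∀ x y : g, TN N x y = π (φ x y))
    -- `φ = N*ψ`:
    (hψ : IsAlt3 ψ)
    (hφψ : ∀ x y z : g, φ x y z = ψ (N x) (N y) (N z)) :
    ∀ α β : Dual ℝ g,
      N.dualMap (coad (N (π α)) β - coad (N (π β)) α + ψ (N (π α)) (N (π β))) =
        brP π (N.dualMap α) (N.dualMap β) := by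
  intro α β
  ext x
  have hN : ∀ γ : Dual ℝ g, π (γ ∘ₗ N) = N (π γ) := fun γ => (LinearMap.congr_fun hNπ γ).symm
  have hMM := LinearMap.congr_fun (hC (N.dualMap α) β) x
  have hT := congrArg α (hTN x (π β))
  rw [hskew] at hT
  -- cyclic invariance of `φ`, from its two antisymmetries
  have h12 : φ x (π β) (π α) = -φ (π β) x (π α) := by
    have h := hφ.1 (x + π β) (π α)
    simp only [map_add, LinearMap.add_apply, hφ.1] at h
    linarith
  have h23 : φ (π β) x (π α) = -φ (π β) (π α) x := by
    have h := hφ.2 (π β) (x + π α)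
    simp only [map_add, LinearMap.add_apply, hφ.2] at h
    linarith
  have h12' : φ (π β) (π α) x = -φ (π α) (π β) x := by
    have h := hφ.1 (π α + π β) x
    simp only [map_add, LinearMap.add_apply, hφ.1] at h
    linarith
  have hψx := hφψ (π α) (π β) x
  have e₁ : ⁅N x, N (π β)⁆ = -⁅N (π β), N x⁆ := (lie_skew _ _).symm
  have e₂ : ⁅N x, π β⁆ = -⁅π β, N x⁆ := (lie_skew _ _).symm
  have e₃ : ⁅x, N (π β)⁆ = -⁅N (π β), x⁆ := (lie_skew _ _).symm
  have e₄ : ⁅x, π β⁆ = -⁅π β, x⁆ := (lie_skew _ _).symm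
  simp only [MM, brNP, brPNt, brP, coad, TN, brN, LinearMap.dualMap_apply', hN, e₁, e₂, e₃, e₄,
    LinearMap.sub_apply, LinearMap.add_apply, LinearMap.neg_apply, LinearMap.comp_apply,
    LieAlgebra.ad_apply, LinearMap.zero_apply, map_sub, map_add, map_neg] at hMM hT ⊢
  linarith
end
end

section
/- Let g be a finite-dimensional real Lie algebra, φ an alternating trilinear form on g, and 𝒩 a paired linear endomorphism of g ⊕ g* with components (N, π, σ, −N^t) satisfying 𝒩² = −Id. Then T^φ_𝒩(α,β) = 0 for all α, β ∈ g* (torsion with respect to the φ-twisted double bracket) if and only if both: (i) π([α,β]_π) = [π(α), π(β)] for all α, β ∈ g*, and (ii) [α,β]_π^{N^t} − [α,β]_{Nπ} = φ(π(α), π(β), ·) for all α, β ∈ g*. -/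
noncomputable section
open Module

variable {g : Type*} [LieRing g] [LieAlgebra ℝ g]

lemma coad_neg (x : g) (γ : Dual ℝ g) : coad x (-γ) = -coad x γ := by
  simp [coad, LinearMap.neg_comp]

lemma coad_zero_left (γ : Dual ℝ g) : coad (0 : g) γ = 0 := by
  simp [coad]

/-- The torsion on `g*`, for an operator whose bivector part intertwines `N` and its transpose. -/
lemma TcalT_dual (φ : g →ₗ[ℝ] g →ₗ[ℝ] Dual ℝ g)
    (N : g →ₗ[ℝ] g) (π : Dual ℝ g →ₗ[ℝ] g) (𝒩 : g × Dual ℝ g →ₗ[ℝ] g × Dual ℝ g)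
    (h𝒩 : ∀ α : Dual ℝ g, 𝒩 (0, α) = (π α, -N.dualMap α))
    (hcomm : ∀ α : Dual ℝ g, π (N.dualMap α) = N (π α)) (α β : Dual ℝ g) :
    TcalT φ 𝒩 ((0 : g), α) ((0 : g), β) =
      (⁅π α, π β⁆ - π (brP π α β),
        φ (π α) (π β) - (brPNt π N α β - brNP π N α β)) := by
  have hdef : dblTN φ 𝒩 ((0 : g), α) ((0 : g), β) = (0, brP π α β) := by
    ext1 <;> simp [dblTN, dblT, h𝒩, brP, coad_zero_left, sub_eq_add_neg]
  rw [TcalT, hdef, h𝒩, h𝒩, h𝒩]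
  ext1
  · simp [dblT]
  · simp only [dblT, brPNt, brNP, Prod.snd_sub, coad_neg]
    simp only [brP, hcomm]
    abel

theorem twisted_torsion_on_dual_iff [FiniteDimensional ℝ g]
    (φ : g →ₗ[ℝ] g →ₗ[ℝ] Dual ℝ g) (hφ : IsAlt3 φ)
    (N : g →ₗ[ℝ] g) (π : Dual ℝ g →ₗ[ℝ] g) (σ : g →ₗ[ℝ] Dual ℝ g)
    (𝒩 : g × Dual ℝ g →ₗ[ℝ] g × Dual ℝ g)
    (hpair : Paired 𝒩)
    (hcomp : ∀ (x : g) (α : Dual ℝ g), 𝒩 (x, α) = (N x + π α, σ x - N.dualMap α))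
    (hsq : ∀ e : g × Dual ℝ g, 𝒩 (𝒩 e) = -e) :
    (∀ α β : Dual ℝ g, TcalT φ 𝒩 ((0 : g), α) ((0 : g), β) = 0) ↔
      ((∀ α β : Dual ℝ g, π (brP π α β) = ⁅π α, π β⁆) ∧
        (∀ α β : Dual ℝ g, brPNt π N α β - brNP π N α β = φ (π α) (π β))) := by
  have h𝒩 (α : Dual ℝ g) : 𝒩 (0, α) = (π α, -N.dualMap α) := by
    simp [hcomp]
  have hcomm (α : Dual ℝ g) : π (N.dualMap α) = N (π α) := by
    have h := congrArg Prod.fst (hsq (0, α))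
    rw [h𝒩, hcomp] at h
    simp only [map_neg, Prod.fst_neg, neg_zero] at h
    exact (add_neg_eq_zero.mp h).symm
  simp only [TcalT_dual φ N π 𝒩 h𝒩 hcomm, Prod.mk_eq_zero, sub_eq_zero, forall_and]
  exact and_congr (forall₂_congr fun _ _ => eq_comm) (forall₂_congr fun _ _ => eq_comm)
end
end
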